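/- Let p ≥ 1, t ≥ 1, and suppose m is a positive integer with 2^m ≤ (m e/(p+1))^{t(p+1)}. Then m ≤ (4/ln 2)·p(t+1)·ln(2p(t+1)). -/

import Mathlib

/-- The tangent-line bound for the logarithm with a free slope `γ`. -/
lemma Real.log_le_mul_sub_log_sub_one {x γ : ℝ} (hx : 0 < x) (hγ : 0 < γ) :
    Real.log x ≤ γ * x - Real.log γ - 1 := by
  have h := Real.log_le_sub_one_of_pos (mul_pos hγ hx)
  rw [Real.log_mul hγ.ne' hx.ne'] at h
  linarith

lemma two_mul_log_four_mul_div_log_two_le {T N : ℝ} (hT : 1 ≤ T) (hN : T + 1 ≤ N) :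
    2 * Real.log (4 * T / Real.log 2) ≤ 3 * Real.log (2 * N) := by
  have hL : 0.69 < Real.log 2 := by linarith [Real.log_two_gt_d9]
  have hL0 : 0 < Real.log 2 := by linarith
  have hcube : (T + 1) ^ 3 ≤ N ^ 3 := by gcongr
  have hT3 : 27 / 4 * T ^ 2 ≤ (T + 1) ^ 3 := by
    nlinarith [mul_nonneg (sq_nonneg (T - 2)) (by linarith : (0 : ℝ) ≤ T + 1 / 4)]
  have hL2 : 0.69 ^ 2 ≤ Real.log 2 ^ 2 := by gcongr
  have hpow : (4 * T / Real.log 2) ^ 2 ≤ (2 * N) ^ 3 := by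
    rw [div_pow, div_le_iff₀ (by positivity)]
    calc (4 * T) ^ 2 ≤ 54 * T ^ 2 * 0.69 ^ 2 := by nlinarith [sq_nonneg T]
      _ ≤ (2 * N) ^ 3 * Real.log 2 ^ 2 := by
        have hN0 : 0 < N := by linarith
        refine mul_le_mul ?_ hL2 (by positivity) (by positivity)
        rw [mul_pow]
        linarith
  have hlog := Real.log_le_log (by positivity) hpow
  rw [Real.log_pow, Real.log_pow] at hlog
  exact_mod_cast hlog

/-- Solving the growth-function inequality for the VC dimension: if
`2^m ≤ (me/(p+1))^(t(p+1))` then `m ≤ (4/ln 2)·p(t+1)·ln(2p(t+1))`. -/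
theorem vc_dimension_bound (p t m : ℕ) (hp : 1 ≤ p) (ht : 1 ≤ t) (hm : 1 ≤ m)
    (h : (2 : ℝ) ^ m ≤ ((m : ℝ) * Real.exp 1 / (p + 1)) ^ (t * (p + 1))) :
    (m : ℝ) ≤ (4 / Real.log 2) * (p * (t + 1)) * Real.log (2 * p * (t + 1)) := by
  have hP : (1 : ℝ) ≤ p := by exact_mod_cast hp
  have hT : (1 : ℝ) ≤ t := by exact_mod_cast ht
  have hM : (0 : ℝ) < m := by exact_mod_cast hm
  have hL : 0 < Real.log 2 := Real.log_pos one_lt_two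
  have hlog := Real.log_le_log (by positivity) h
  rw [Real.log_pow, Real.log_pow, mul_div_right_comm,
    Real.log_mul (by positivity) (Real.exp_ne_zero 1), Real.log_exp] at hlog
  push_cast at hlog
  have htangent := Real.log_le_mul_sub_log_sub_one (x := (m : ℝ) / (p + 1))
    (γ := (4 * t / Real.log 2)⁻¹) (by positivity) (by positivity)
  rw [Real.log_inv] at htangent
  have hN : (t : ℝ) + 1 ≤ p * (t + 1) := by nlinarith
  have hK := two_mul_log_four_mul_div_log_two_le hT hN
  rw [← mul_assoc] at hK
  have hlogN : 0 ≤ Real.log (2 * p * (t + 1)) := Real.log_nonneg (by nlinarith)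
  have hbound : m * Real.log 2 ≤ m * Real.log 2 / 4
      + t * (p + 1) * Real.log (4 * t / Real.log 2) := by
    calc m * Real.log 2 ≤ t * (p + 1) * (Real.log (m / (p + 1)) + 1) := hlog
      _ ≤ t * (p + 1) * ((4 * t / Real.log 2)⁻¹ * (m / (p + 1))
          + Real.log (4 * t / Real.log 2)) := by gcongr ?_ * ?_; linarith
      _ = _ := by field_simp
  have hfactor : t * (p + 1) * Real.log (4 * t / Real.log 2)
      ≤ 2 * (p * (t + 1)) * (3 / 2 * Real.log (2 * p * (t + 1))) := by
    calc t * (p + 1) * Real.log (4 * t / Real.log 2)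
        ≤ t * (p + 1) * (3 / 2 * Real.log (2 * p * (t + 1))) := by gcongr; linarith
      _ ≤ _ := by gcongr ?_ * _; nlinarith
  rw [div_mul_eq_mul_div, div_mul_eq_mul_div, le_div_iff₀ hL]
  linarith
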